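/- Let N be a positive integer, D < 0 a fundamental discriminant, and ρ an integer with ρ² ≡ D (mod 4N). Then the number of Γ₀(N)-orbits on the set Q_{N,D,ρ} of positive definite forms [Na, b, c] of discriminant D with b ≡ ρ (mod 2N) is equal to h(D), the class number of the imaginary quadratic field ℚ(√D). -/

import Mathlib

/-- `SL(2, ℤ)`. -/
abbrev SL2Z := Matrix.SpecialLinearGroup (Fin 2) ℤ

/-- An integral binary quadratic form `a x² + b x y + c y²`. -/
structure BQF where
  a : ℤ
  b : ℤ
  c : ℤ

namespace BQF

/-- The value of the form at `(x, y)`. -/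
def eval (T : BQF) (x y : ℤ) : ℤ := T.a * x ^ 2 + T.b * x * y + T.c * y ^ 2

/-- The discriminant `b² - 4ac`. -/
def disc (T : BQF) : ℤ := T.b ^ 2 - 4 * T.a * T.c

/-- Positive definiteness. -/
def PosDef (T : BQF) : Prop := ∀ x y : ℤ, ¬(x = 0 ∧ y = 0) → 0 < T.eval x y

/-- The action `T[U]` of `SL(2, ℤ)` on binary quadratic forms:
`T[U](x, y) = T(αx + βy, γx + δy)` for `U = (α β; γ δ)`. -/
def act (T : BQF) (U : SL2Z) : BQF :=
  ⟨T.a * (U.1 0 0) ^ 2 + T.b * (U.1 0 0) * (U.1 1 0) + T.c * (U.1 1 0) ^ 2,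
   2 * T.a * (U.1 0 0) * (U.1 0 1) + T.b * ((U.1 0 0) * (U.1 1 1) + (U.1 0 1) * (U.1 1 0))
     + 2 * T.c * (U.1 1 0) * (U.1 1 1),
   T.a * (U.1 0 1) ^ 2 + T.b * (U.1 0 1) * (U.1 1 1) + T.c * (U.1 1 1) ^ 2⟩

end BQF

/-- `Γ₀(N)`: matrices in `SL(2, ℤ)` whose lower-left entry is divisible by `N`. -/
def Gamma0Set (N : ℕ) : Set SL2Z := {U | (N : ℤ) ∣ U.1 1 0}

/-- `Q_{N,D}`: positive definite forms `[Na, b, c]` of discriminant `D`. -/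
def QND (N : ℕ) (D : ℤ) : Set BQF :=
  {T | T.PosDef ∧ (N : ℤ) ∣ T.a ∧ T.disc = D}

/-- `Q_{N,D,ρ}`: members of `Q_{N,D}` with `b ≡ ρ (mod 2N)`. -/
def QNDrho (N : ℕ) (D ρ : ℤ) : Set BQF :=
  {T | T ∈ QND N D ∧ T.b ≡ ρ [ZMOD (2 * N)]}

/-- `ε(T) = #{U ∈ Γ₀(N) : T[U] = T}`. -/
noncomputable def eps (N : ℕ) (T : BQF) : ℕ :=
  Nat.card {U : SL2Z // U ∈ Gamma0Set N ∧ T.act U = T}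

/-- `R` is a set of representatives for the `Γ₀(N)`-orbits on `S`: every member of `R`
lies in `S`, and every member of `S` is `Γ₀(N)`-equivalent to exactly one member of `R`. -/
def IsOrbitReps (N : ℕ) (S : Set BQF) (R : Finset BQF) : Prop :=
  (∀ T ∈ R, T ∈ S) ∧ ∀ T ∈ S, ∃! T', T' ∈ R ∧ ∃ U ∈ Gamma0Set N, T.act U = T'

/-- A fundamental discriminant: either squarefree and `≡ 1 (mod 4)`, or `4m` with `m`
squarefree and `m ≡ 2, 3 (mod 4)`. -/
def IsFundamentalDiscriminant (D : ℤ) : Prop :=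
  (Squarefree D ∧ D % 4 = 1) ∨
    (∃ m : ℤ, D = 4 * m ∧ Squarefree m ∧ (m % 4 = 2 ∨ m % 4 = 3))

open Polynomial in
theorem aux_minpoly {K : Type} [Field K] [NumberField K] (D : ℤ) (hD : D < 0) (α : K)
    (hα : α ^ 2 = (D : K)) (r s : ℚ) (hs : s ≠ 0) (hzInt : IsIntegral ℤ ((r : K) + s * α)) :
    (∃ u : ℤ, 2 * r = u) ∧ ∃ v : ℤ, r ^ 2 - D * s ^ 2 = v := by
  set z : K := (r : K) + s * α with hz
  have hroot : z ^ 2 - 2 * r * z + (r ^ 2 - D * s ^ 2) = 0 := by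
    rw [hz]; linear_combination (s : K) ^ 2 * hα
  obtain ⟨e, he⟩ : ∃ e : ℚ, e = -2 * r := ⟨_, rfl⟩
  obtain ⟨f, hf⟩ : ∃ f : ℚ, f = r ^ 2 - D * s ^ 2 := ⟨_, rfl⟩
  set p : ℚ[X] := X ^ 2 + C e * X + C f with hp
  have hmonic : p.Monic := by rw [hp]; monicity!
  have hdeg : p.natDegree = 2 := by rw [hp]; compute_degree!
  have hirr : Irreducible p := by
    rw [Polynomial.irreducible_iff_roots_eq_zero_of_degree_le_three (by omega) (by omega)]
    rw [Multiset.eq_zero_iff_forall_notMem]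
    intro x hx
    have := Polynomial.isRoot_of_mem_roots hx
    simp [hp] at this
    rw [he, hf] at this
    have h1 : (x - r) ^ 2 = D * s ^ 2 := by linear_combination this
    have h2 : (D : ℚ) < 0 := by exact_mod_cast hD
    have h3 : 0 < s ^ 2 := by positivity
    nlinarith [sq_nonneg (x - r), mul_neg_of_neg_of_pos h2 h3]
  have hev : Polynomial.aeval z p = 0 := by
    simp [hp]
    rw [he, hf]
    push_cast
    linear_combination hroot
  have hmin := minpoly.eq_of_irreducible_of_monic hirr hev hmonic
  have hZ := minpoly.isIntegrallyClosed_eq_field_fractions' ℚ hzInt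
  rw [← hmin] at hZ
  constructor
  · have := congrArg (fun q => q.coeff 1) hZ
    simp [hp] at this
    refine ⟨-(minpoly ℤ z).coeff 1, ?_⟩
    push_cast
    linarith
  · have := congrArg (fun q => q.coeff 0) hZ
    simp [hp] at this
    exact ⟨_, hf ▸ this⟩

theorem aux_span {K : Type} [Field K] [NumberField K] (D : ℤ) (hD : D < 0) (hdeg : Module.finrank ℚ K = 2) (α : K)
    (hα : α ^ 2 = (D : K)) : (∀ r s : ℚ, (r : K) + s * α = 0 → r = 0 ∧ s = 0) ∧
      ∀ z : K, ∃ r s : ℚ, z = r + s * α := by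
  have h1 : ∀ r s : ℚ, (r : K) + s * α = 0 → r = 0 ∧ s = 0 := by
    intro r s h
    have h2 : (r : K) ^ 2 = D * s ^ 2 := by
      linear_combination (r - s * α) * h + s ^ 2 * hα
    have h3 : r ^ 2 = D * s ^ 2 := by exact_mod_cast h2
    have h2 : (D : ℚ) < 0 := by exact_mod_cast hD
    have hs : s = 0 := by
      by_contra hs
      have h3 : 0 < s ^ 2 := by positivity
      nlinarith [sq_nonneg r, mul_neg_of_neg_of_pos h2 h3]
    subst hs
    simpa using h3
  refine ⟨h1, ?_⟩
  have hli : LinearIndependent ℚ ![(1 : K), α] := by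
    rw [LinearIndependent.pair_iff]
    intro s t h
    apply h1
    simpa [Algebra.smul_def] using h
  have htop := hli.span_eq_top_of_card_eq_finrank' (by simp [hdeg])
  intro z
  have : z ∈ Submodule.span ℚ (Set.range ![(1 : K), α]) := by rw [htop]; trivial
  simp [Submodule.mem_span_pair] at this
  obtain ⟨r, s, h⟩ := this
  exact ⟨s, r, by rw [← h, add_comm]; simp [Algebra.smul_def]⟩

theorem aux_sqf (m : ℤ) (hm : Squarefree m) (v : ℚ) (w : ℤ) (h : m * v ^ 2 = w) :
    ∃ k : ℤ, v = k := by
  have hden : v.den = 1 := by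
    have hv : v = v.num / v.den := (Rat.num_div_den v).symm
    have hd : (v.den : ℚ) ≠ 0 := by exact_mod_cast v.den_nz
    have h1 : (m : ℚ) * v.num ^ 2 = w * v.den ^ 2 := by
      rw [hv] at h
      field_simp at h
      simpa [mul_comm] using h
    have h2 : m * v.num ^ 2 = w * (v.den : ℤ) ^ 2 := by exact_mod_cast h1
    have hc : IsCoprime ((v.den : ℤ) ^ 2) (v.num ^ 2) := by
      apply IsCoprime.pow
      rw [Int.isCoprime_iff_gcd_eq_one, Int.gcd_comm]
      exact v.reduced
    have h3 : (v.den : ℤ) ^ 2 ∣ m := hc.dvd_of_dvd_mul_right (Dvd.intro_left _ h2.symm)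
    have := hm (v.den : ℤ) (by rwa [← sq])
    have := Int.isUnit_iff.1 this
    have := v.den_nz
    omega
  exact ⟨v.num, (Rat.den_eq_one_iff v).1 hden |>.symm⟩

/-- `1, ω` is an integral basis of `O`, with `ω² = tω - n`. -/
structure QBasis (O : Type) [CommRing O] (t n : ℤ) (ω : O) : Prop where
  sq : ω ^ 2 = t * ω - n
  ex : ∀ z : O, ∃ x y : ℤ, z = x + y * ω
  uniq : ∀ x y : ℤ, (x : O) + y * ω = 0 → x = 0 ∧ y = 0

theorem aux_coords (D : ℤ) (hD : IsFundamentalDiscriminant D) :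
    ∃ t n : ℤ, D = t ^ 2 - 4 * n ∧ ∀ r s : ℚ, (∃ u : ℤ, 2 * r = u) →
      (∃ v : ℤ, r ^ 2 - D * s ^ 2 = v) → ∃ x y : ℤ, r = x + y * t / 2 ∧ s = y / 2 := by
  rcases hD with ⟨hsq, h1⟩ | ⟨m, rfl, hsq, hm⟩
  · refine ⟨1, (1 - D) / 4, by omega, ?_⟩
    rintro r s ⟨u, hu⟩ ⟨v, hv⟩
    obtain ⟨k, hk⟩ := aux_sqf D hsq (2 * s) (u ^ 2 - 4 * v) (by
      push_cast
      rw [← hu, ← hv]; ring)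
    have h4 : u ^ 2 - D * k ^ 2 = 4 * v := by
      have : (u : ℚ) ^ 2 - D * k ^ 2 = 4 * v := by rw [← hu, ← hv, ← hk]; ring
      exact_mod_cast this
    have h5 : (2 : ℤ) ∣ u - k := by
      obtain ⟨e, he⟩ : ∃ e, D = 4 * e + 1 := ⟨D / 4, by omega⟩
      have : (u - k) * (u - k) = 2 * (2 * v + 2 * e * k ^ 2 - k * u + k ^ 2) := by
        rw [he] at h4; linear_combination h4
      rcases Int.prime_two.dvd_or_dvd (Dvd.intro _ this.symm) with h | h <;> exact h
    obtain ⟨x, hx⟩ := h5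
    refine ⟨x, k, ?_, by linarith⟩
    have : (u : ℚ) - k = 2 * x := by exact_mod_cast hx
    push_cast
    linarith
  · refine ⟨0, -m, by ring, ?_⟩
    rintro r s ⟨u, hu⟩ ⟨v, hv⟩
    obtain ⟨k, hk⟩ := aux_sqf m hsq (4 * s) (u ^ 2 - 4 * v) (by
      push_cast
      rw [← hu, ← hv]; push_cast; ring)
    have h4 : u ^ 2 - m * k ^ 2 = 4 * v := by
      have : (u : ℚ) ^ 2 - m * k ^ 2 = 4 * v := by rw [← hu, ← hv, ← hk]; push_cast; ring
      exact_mod_cast this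
    obtain ⟨e, he⟩ : ∃ e, m = 4 * e + 2 ∨ m = 4 * e + 3 := ⟨m / 4, by omega⟩
    have h5 : ∃ x y, u = 2 * x ∧ k = 2 * y := by
      rcases Int.even_or_odd' u with ⟨x, hx | hx⟩ <;> rcases Int.even_or_odd' k with ⟨y, hy | hy⟩
      · exact ⟨x, y, hx, hy⟩
      all_goals
        exfalso
        subst hx hy
        rcases he with rfl | rfl <;> ring_nf at h4 <;> omega
    obtain ⟨x, y, rfl, rfl⟩ := h5
    push_cast at hu hk
    exact ⟨x, y, by push_cast; linarith, by linarith⟩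

theorem aux_basis {K : Type} [Field K] [NumberField K] (D : ℤ) (hDneg : D < 0)
    (hD : IsFundamentalDiscriminant D) (hdeg : Module.finrank ℚ K = 2) (α : K)
    (hα : α ^ 2 = (D : K)) : ∃ (t n : ℤ) (ω : NumberField.RingOfIntegers K),
      D = t ^ 2 - 4 * n ∧ QBasis (NumberField.RingOfIntegers K) t n ω := by
  obtain ⟨t, n, hDtn, hc⟩ := aux_coords D hD
  obtain ⟨hu, hs⟩ := aux_span D hDneg hdeg α hα
  have hDK : (D : K) = t ^ 2 - 4 * n := by rw [hDtn]; push_cast; ring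
  have hsq : ((t + α) / 2) ^ 2 = t * ((t + α) / 2) - (n : K) := by
    field_simp
    linear_combination hα + hDK
  have hzInt : IsIntegral ℤ ((t + α) / 2 : K) := by
    refine ⟨Polynomial.X ^ 2 + Polynomial.C (-t) * Polynomial.X + Polynomial.C n, by monicity!, ?_⟩
    rw [← Polynomial.aeval_def]
    simp
    linear_combination hsq
  obtain ⟨ω, hω⟩ : ∃ ω : NumberField.RingOfIntegers K,
      algebraMap (NumberField.RingOfIntegers K) K ω = (t + α) / 2 := ⟨⟨_, hzInt⟩, rfl⟩
  rw [← hω] at hsq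
  refine ⟨t, n, ω, hDtn, ⟨?_, ?_, ?_⟩⟩
  · apply NumberField.RingOfIntegers.ext
    simpa using hsq
  · intro z
    obtain ⟨r, s, hz⟩ := hs z
    have : (∃ u : ℤ, 2 * r = u) ∧ ∃ v : ℤ, r ^ 2 - D * s ^ 2 = v := by
      have hzi : IsIntegral ℤ ((r : K) + s * α) := by
        rw [← hz]; exact z.isIntegral_coe
      by_cases h0 : s = 0
      · subst h0
        have : IsIntegral ℤ r := by
          rw [← isIntegral_algebraMap_iff (algebraMap ℚ K).injective]
          simpa using hzi
        obtain ⟨k, hk⟩ := IsIntegrallyClosed.isIntegral_iff.1 this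
        simp at hk
        subst hk
        exact ⟨⟨2 * k, by push_cast; ring⟩, ⟨k ^ 2, by push_cast; ring⟩⟩
      · exact aux_minpoly D hDneg α hα r s h0 hzi
    obtain ⟨x, y, hr, hs⟩ := hc r s this.1 this.2
    refine ⟨x, y, ?_⟩
    apply NumberField.RingOfIntegers.ext
    simp
    rw [hz, hr, hs, hω]
    push_cast
    ring
  · intro x y h
    have h := congrArg (fun z : NumberField.RingOfIntegers K => (z : K)) h
    simp [hω] at h
    have := hu (x + y * t / 2) (y / 2) (by push_cast; linear_combination h)
    have hy : y = 0 := by simpa using this.2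
    subst hy
    simpa using this.1

theorem act_disc (T : BQF) (U : SL2Z) : (T.act U).disc = T.disc := by
  have h := U.2
  rw [Matrix.det_fin_two] at h
  simp only [BQF.act, BQF.disc]
  linear_combination (T.b ^ 2 - 4 * T.a * T.c) *
    (U.1 0 0 * U.1 1 1 - U.1 0 1 * U.1 1 0 + 1) * h

theorem act_mul (T : BQF) (U V : SL2Z) : (T.act U).act V = T.act (U * V) := by
  simp only [BQF.act, Matrix.SpecialLinearGroup.coe_mul, Matrix.mul_apply, Fin.sum_univ_two,
    BQF.mk.injEq]
  refine ⟨?_, ?_, ?_⟩ <;> ring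

theorem posDef_a {T : BQF} (h : T.PosDef) : 0 < T.a := by
  have := h 1 0 (by simp)
  simpa [BQF.eval] using this

theorem posDef_of {T : BQF} (h : 0 < T.a) (hd : T.disc < 0) : T.PosDef := by
  intro x y hxy
  have h4 : 4 * T.a * T.eval x y = (2 * T.a * x + T.b * y) ^ 2 - T.disc * y ^ 2 := by
    simp only [BQF.eval, BQF.disc]; ring
  have : 0 < 4 * T.a * T.eval x y := by
    rw [h4]
    by_cases hy : y = 0
    · subst hy
      have hx : x ≠ 0 := fun h => hxy ⟨h, rfl⟩
      have : T.a * x ≠ 0 := mul_ne_zero h.ne' hx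
      have : 0 < (T.a * x) ^ 2 := by positivity
      nlinarith
    · have : 0 < y ^ 2 := by positivity
      nlinarith [sq_nonneg (2 * T.a * x + T.b * y), mul_neg_of_neg_of_pos hd this]
  exact pos_of_mul_pos_right this (by linarith)

theorem act_posDef {T : BQF} (h : T.PosDef) (hd : T.disc < 0) (U : SL2Z) : (T.act U).PosDef := by
  apply posDef_of
  · have := h (U.1 0 0) (U.1 1 0) (by
      rintro ⟨h1, h2⟩
      have h := U.2
      rw [Matrix.det_fin_two, h1, h2] at h
      simp at h)
    exact this
  · rwa [act_disc]

theorem aux_prim {D : ℤ} (hD : IsFundamentalDiscriminant D) {T : BQF} (hT : T.disc = D) :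
    ∃ u v w : ℤ, u * T.a + v * T.b + w * T.c = 1 := by
  obtain ⟨g, hg⟩ : ∃ g : ℤ, g = gcd T.a (gcd T.b T.c) := ⟨_, rfl⟩
  have ha : g ∣ T.a := hg ▸ gcd_dvd_left _ _
  have hbc : g ∣ gcd T.b T.c := hg ▸ gcd_dvd_right _ _
  have hb : g ∣ T.b := hbc.trans (gcd_dvd_left _ _)
  have hc : g ∣ T.c := hbc.trans (gcd_dvd_right _ _)
  obtain ⟨u, v, huv⟩ := exists_gcd_eq_mul_add_mul T.a (gcd T.b T.c)
  obtain ⟨x, y, hxy⟩ := exists_gcd_eq_mul_add_mul T.b T.c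
  have hgu : IsUnit g := by
    obtain ⟨a, ha⟩ := ha
    obtain ⟨b, hb⟩ := hb
    obtain ⟨c, hc⟩ := hc
    have hd : g * g * (b ^ 2 - 4 * a * c) = D := by
      rw [← hT, BQF.disc, ha, hb, hc]; ring
    rcases hD with ⟨hsq, h1⟩ | ⟨m, rfl, hsq, hm⟩
    · exact hsq g (Dvd.intro _ hd)
    · rcases Int.even_or_odd' g with ⟨h, rfl | rfl⟩
      · exfalso
        have h2 : h * h * (b ^ 2 - 4 * a * c) = m := by linarith
        have h3 : h * h = 1 := by
          rcases Int.isUnit_iff.1 (hsq h (Dvd.intro _ h2)) with rfl | rfl <;> rfl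
        rw [h3, one_mul] at h2
        rcases Int.even_or_odd' b with ⟨k, rfl | rfl⟩ <;> ring_nf at h2 <;> omega
      · apply hsq
        have : IsCoprime ((2 * h + 1) * (2 * h + 1)) (4 : ℤ) :=
          ⟨1, -(h ^ 2 + h), by ring⟩
        exact this.dvd_of_dvd_mul_left (Dvd.intro _ hd)
  rw [← hg, hxy] at huv
  rcases Int.isUnit_iff.1 hgu with h1 | h1
  · exact ⟨u, x * v, y * v, by rw [h1] at huv; linear_combination -huv⟩
  · exact ⟨-u, -x * v, -y * v, by rw [h1] at huv; linear_combination huv⟩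

theorem aux_rep (N : ℕ) (hN : 0 < N) {T : BQF}
    (hT : ∃ u v w : ℤ, u * T.a + v * T.b + w * T.c = 1) :
    ∃ x y : ℤ, IsCoprime x y ∧ IsCoprime (T.eval x y) N := by
  classical
  let X : ℤ := ∏ p ∈ N.primeFactors.filter (fun p : ℕ => (p : ℤ) ∣ T.a ∧ ¬ (p : ℤ) ∣ T.c), (p : ℤ)
  let Y : ℤ := ∏ p ∈ N.primeFactors.filter (fun p : ℕ => ¬ (p : ℤ) ∣ T.a), (p : ℤ)
  have hX : ∀ p : ℕ, p.Prime → ((p : ℤ) ∣ X ↔ p ∣ N ∧ (p : ℤ) ∣ T.a ∧ ¬ (p : ℤ) ∣ T.c) := by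
    intro p hp
    have hpp := Nat.prime_iff_prime_int.1 hp
    rw [Prime.dvd_finsetProd_iff hpp]
    constructor
    · rintro ⟨q, hq, hpq⟩
      simp only [Finset.mem_filter, Nat.mem_primeFactors] at hq
      have : p = q := (Nat.prime_dvd_prime_iff_eq hp hq.1.1).1 (by exact_mod_cast hpq)
      subst this
      exact ⟨hq.1.2.1, hq.2⟩
    · rintro ⟨h1, h2⟩
      exact ⟨p, by
        simp only [Finset.mem_filter, Nat.mem_primeFactors]
        exact ⟨⟨hp, h1, hN.ne'⟩, h2⟩, dvd_rfl⟩
  have hY : ∀ p : ℕ, p.Prime → ((p : ℤ) ∣ Y ↔ p ∣ N ∧ ¬ (p : ℤ) ∣ T.a) := by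
    intro p hp
    have hpp := Nat.prime_iff_prime_int.1 hp
    rw [Prime.dvd_finsetProd_iff hpp]
    constructor
    · rintro ⟨q, hq, hpq⟩
      simp only [Finset.mem_filter, Nat.mem_primeFactors] at hq
      have : p = q := (Nat.prime_dvd_prime_iff_eq hp hq.1.1).1 (by exact_mod_cast hpq)
      subst this
      exact ⟨hq.1.2.1, hq.2⟩
    · rintro ⟨h1, h2⟩
      exact ⟨p, by
        simp only [Finset.mem_filter, Nat.mem_primeFactors]
        exact ⟨⟨hp, h1, hN.ne'⟩, h2⟩, dvd_rfl⟩
  have key : ∀ a b : ℤ, (∀ p : ℕ, p.Prime → (p : ℤ) ∣ a → (p : ℤ) ∣ b → False) → IsCoprime a b := by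
    intro a b h
    rw [Int.isCoprime_iff_gcd_eq_one]
    by_contra hne
    obtain ⟨p, hp, hpd⟩ := Nat.exists_prime_and_dvd hne
    have hpd : (p : ℤ) ∣ (Int.gcd a b : ℤ) := by exact_mod_cast hpd
    exact h p hp (hpd.trans (Int.gcd_dvd_left ..)) (hpd.trans (Int.gcd_dvd_right ..))
  refine ⟨X, Y, key _ _ ?_, key _ _ ?_⟩
  · intro p hp h1 h2
    exact ((hY p hp).1 h2).2 ((hX p hp).1 h1).2.1
  · intro p hp h1 h2
    have hpp := Nat.prime_iff_prime_int.1 hp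
    have hpN : p ∣ N := by exact_mod_cast h2
    have hx := hX p hp
    have hy := hY p hp
    simp only [hpN, true_and] at hx hy
    simp only [BQF.eval] at h1
    by_cases hA : (p : ℤ) ∣ T.a
    · have hny : ¬ (p : ℤ) ∣ Y := fun h => hy.1 h hA
      by_cases hC : (p : ℤ) ∣ T.c
      · have hnx : ¬ (p : ℤ) ∣ X := fun h => (hx.1 h).2 hC
        have h3 : (p : ℤ) ∣ T.b * X * Y := by
          have e : T.b * X * Y = (T.a * X ^ 2 + T.b * X * Y + T.c * Y ^ 2) - T.a * X ^ 2
            - T.c * Y ^ 2 := by ring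
          rw [e]
          exact dvd_sub (dvd_sub h1 (hA.mul_right _)) (hC.mul_right _)
        rcases hpp.dvd_or_dvd h3 with h4 | h4
        · rcases hpp.dvd_or_dvd h4 with h5 | h5
          · obtain ⟨u, v, w, huvw⟩ := hT
            apply hpp.not_dvd_one
            rw [← huvw]
            exact dvd_add (dvd_add (hA.mul_left _) (h5.mul_left _)) (hC.mul_left _)
          · exact hnx h5
        · exact hny h4
      · have hxx : (p : ℤ) ∣ X := hx.2 ⟨hA, hC⟩
        have h3 : (p : ℤ) ∣ T.c * Y ^ 2 := by
          have e : T.c * Y ^ 2 = (T.a * X ^ 2 + T.b * X * Y + T.c * Y ^ 2) -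
            X * (T.a * X + T.b * Y) := by ring
          rw [e]
          exact dvd_sub h1 (hxx.mul_right _)
        rcases hpp.dvd_or_dvd h3 with h4 | h4
        · exact hC h4
        · exact hny (hpp.dvd_of_dvd_pow h4)
    · have hyy : (p : ℤ) ∣ Y := hy.2 hA
      have hnx : ¬ (p : ℤ) ∣ X := fun h => hA (hx.1 h).1
      have h3 : (p : ℤ) ∣ T.a * X ^ 2 := by
        have e : T.a * X ^ 2 = (T.a * X ^ 2 + T.b * X * Y + T.c * Y ^ 2) -
          Y * (T.c * Y + T.b * X) := by ring
        rw [e]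
        exact dvd_sub h1 (hyy.mul_right _)
      rcases hpp.dvd_or_dvd h3 with h4 | h4
      · exact hA h4
      · exact hnx (hpp.dvd_of_dvd_pow h4)

theorem aux_upgrade (N : ℕ) (hN : 0 < N) {D : ℤ} (hDneg : D < 0)
    (hD : IsFundamentalDiscriminant D) (ρ : ℤ) (hρ : ρ ^ 2 ≡ D [ZMOD (4 * N)])
    {T : BQF} (hT : T.disc = D) (hpos : T.PosDef) : ∃ U : SL2Z, T.act U ∈ QNDrho N D ρ := by
  obtain ⟨x, y, ⟨s, q, hsq⟩, hcop⟩ := aux_rep N hN (aux_prim hD hT)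
  let U : SL2Z := ⟨!![x, -q; y, s], by rw [Matrix.det_fin_two_of]; linarith⟩
  have hUa : (T.act U).a = T.eval x y := by simp [BQF.act, BQF.eval, U]
  obtain ⟨T1, hT1⟩ : ∃ T1, T1 = T.act U := ⟨_, rfl⟩
  rw [← hT1] at hUa
  have hd1 : T1.disc = D := by rw [hT1, act_disc, hT]
  rw [← hUa] at hcop
  obtain ⟨d, hd⟩ := (Int.modEq_iff_dvd.1 hρ)
  have hpar : (2 : ℤ) ∣ -ρ - T1.b := by
    have h1 : (-ρ - T1.b) * (-ρ - T1.b) =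
        2 * (-2 * N * d - 2 * T1.a * T1.c + T1.b ^ 2 + ρ * T1.b) := by
      simp only [BQF.disc] at hd1
      linear_combination -hd - hd1
    rcases Int.prime_two.dvd_or_dvd (Dvd.intro _ h1.symm) with h | h <;> exact h
  obtain ⟨e, he⟩ := hpar
  obtain ⟨u, v, huv⟩ := hcop
  let V : SL2Z := ⟨!![1, e * u; 0, 1], by rw [Matrix.det_fin_two_of]; ring⟩
  let S : SL2Z := ⟨!![0, -1; 1, 0], by rw [Matrix.det_fin_two_of]; ring⟩
  have hb : (T1.act (V * S)).b = -(2 * T1.a * (e * u) + T1.b) := by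
    rw [← act_mul]; simp [BQF.act, V, S]
  have hc : (T1.act (V * S)).c = T1.a := by
    rw [← act_mul]; simp [BQF.act, V, S]
  have hd2 : (T1.act (V * S)).disc = D := by rw [act_disc, hd1]
  have hact : T.act (U * (V * S)) = T1.act (V * S) := by rw [hT1, act_mul]
  refine ⟨U * (V * S), ⟨act_posDef hpos (hT ▸ hDneg) _, ?_, ?_⟩, ?_⟩
  · rw [hact]
    obtain ⟨a2, ha2⟩ : ∃ a2, a2 = (T1.act (V * S)).a := ⟨_, rfl⟩
    rw [BQF.disc, hb, hc, ← ha2] at hd2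
    rw [← ha2]
    have hcop : IsCoprime (N : ℤ) T1.a := ⟨v, u, by linarith⟩
    apply hcop.dvd_of_dvd_mul_right
    -- `2 * a1 * e * u + b1 = -ρ - 2 e v N`
    have h3 : 2 * T1.a * (e * u) + T1.b = -ρ - 2 * e * v * N := by
      linear_combination 2 * e * huv - he
    rw [h3] at hd2
    have h4 : 4 * (a2 * T1.a) = 4 * (N * (ρ * e * v + e ^ 2 * v ^ 2 * N - d)) := by
      linear_combination -hd2 - hd
    exact Dvd.intro _ (mul_left_cancel₀ (by norm_num) h4).symm
  · rw [act_disc, hT]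
  · rw [hact, hb]
    apply Int.ModEq.symm
    rw [Int.modEq_iff_dvd]
    exact ⟨e * v, by linear_combination -2 * e * huv + he⟩

theorem aux_gamma0 (N : ℕ) {D ρ : ℤ} (hD : IsFundamentalDiscriminant D) {T T' : BQF}
    (hT : T ∈ QNDrho N D ρ) (hT' : T' ∈ QNDrho N D ρ) (U : SL2Z) (hU : T.act U = T') :
    U ∈ Gamma0Set N := by
  obtain ⟨⟨_, ⟨a, ha⟩, hd⟩, hb⟩ := hT
  obtain ⟨⟨_, ⟨a', ha'⟩, hd'⟩, hb'⟩ := hT'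
  obtain ⟨u, v, w, huvw⟩ := aux_prim hD hd
  obtain ⟨k, hk⟩ := Int.modEq_iff_dvd.1 (hb.trans hb'.symm)
  have hdet := U.2
  rw [Matrix.det_fin_two] at hdet
  subst hU
  simp only [BQF.act] at ha' hk
  show (N : ℤ) ∣ U.1 1 0
  generalize U.1 0 0 = p at *
  generalize U.1 0 1 = q at *
  generalize U.1 1 0 = r at *
  generalize U.1 1 1 = s at *
  have h1 : r * (T.b * p + T.c * r) = N * (a' - a * p ^ 2) := by
    rw [ha] at ha'; linear_combination ha'
  have h2 : r * (T.b * q + T.c * s) = N * (k - a * p * q) := by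
    rw [ha] at hk
    have : 2 * (r * (T.b * q + T.c * s)) = 2 * (N * (k - a * p * q)) := by
      linear_combination hk - T.b * hdet
    linarith
  have h3 : r * T.b = N * ((a' - a * p ^ 2) * s - (k - a * p * q) * r) := by
    linear_combination s * h1 - r * h2 - r * T.b * hdet
  have h4 : r * T.c = N * ((k - a * p * q) * p - (a' - a * p ^ 2) * q) := by
    linear_combination p * h2 - q * h1 - r * T.c * hdet
  refine ⟨r * u * a + v * ((a' - a * p ^ 2) * s - (k - a * p * q) * r) +
    w * ((k - a * p * q) * p - (a' - a * p ^ 2) * q), ?_⟩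
  rw [ha] at huvw
  linear_combination -r * huvw + v * h3 + w * h4

/-- The element `(b + √D)/2` attached to a form. -/
def bet {O : Type} [CommRing O] (t : ℤ) (ω : O) (T : BQF) : O := ω + (((T.b - t) / 2 : ℤ) : O)

/-- The ideal `(a, (b + √D)/2)` attached to a form. -/
def formIdeal {O : Type} [CommRing O] (t : ℤ) (ω : O) (T : BQF) : Ideal O :=
  Ideal.span {(T.a : O), bet t ω T}

theorem form_k {t n : ℤ} {T : BQF} (h : T.disc = t ^ 2 - 4 * n) :
    ∃ k : ℤ, (T.b - t) / 2 = k ∧ T.b = t + 2 * k ∧ T.a * T.c = k ^ 2 + t * k + n := by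
  simp only [BQF.disc] at h
  have h2 : (2 : ℤ) ∣ T.b - t := by
    have h1 : (T.b - t) * (T.b - t) = 2 * (2 * T.a * T.c - 2 * n + t ^ 2 - T.b * t) := by
      linear_combination h
    rcases Int.prime_two.dvd_or_dvd (Dvd.intro _ h1.symm) with h | h <;> exact h
  obtain ⟨k, hk⟩ := h2
  refine ⟨k, by omega, by omega, ?_⟩
  have hb : T.b = t + 2 * k := by omega
  rw [hb] at h
  linarith

section
variable {O : Type} [CommRing O] {t n : ℤ} {ω : O}

theorem mem_formIdeal (h : QBasis O t n ω) {T : BQF} (hT : T.disc = t ^ 2 - 4 * n) (z : O) :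
    z ∈ formIdeal t ω T ↔ ∃ x y : ℤ, z = x * T.a + y * bet t ω T := by
  rw [formIdeal, Ideal.mem_span_pair]
  constructor
  · rintro ⟨u, v, rfl⟩
    obtain ⟨u1, u2, rfl⟩ := h.ex u
    obtain ⟨v1, v2, rfl⟩ := h.ex v
    obtain ⟨k, hk, hb, hac⟩ := form_k hT
    have hac : (T.a : O) * T.c = k ^ 2 + t * k + n := by exact_mod_cast congrArg (Int.cast (R := O)) hac
    refine ⟨u1 - u2 * k - v2 * T.c, u2 * T.a + v1 + v2 * (t + k), ?_⟩
    simp only [bet, hk]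
    push_cast
    linear_combination (v2 : O) * h.sq + v2 * hac
  · rintro ⟨x, y, rfl⟩
    exact ⟨x, y, rfl⟩

theorem uniq_formIdeal (h : QBasis O t n ω) {T : BQF} (ha : T.a ≠ 0) {x y : ℤ}
    (hxy : (x : O) * T.a + y * bet t ω T = 0) : x = 0 ∧ y = 0 := by
  simp only [bet] at hxy
  have := h.uniq (x * T.a + y * ((T.b - t) / 2)) y (by push_cast; linear_combination hxy)
  have hy := this.2
  subst hy
  simpa [ha] using this

theorem bet_act (h : QBasis O t n ω) {T : BQF} (hT : T.disc = t ^ 2 - 4 * n) (U : SL2Z) :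
    ((U.1 0 0 : ℤ) * (T.a : O) + (U.1 1 0 : ℤ) * bet t ω T) * bet t ω (T.act U) =
      (T.act U).a * ((U.1 0 1 : ℤ) * (T.a : O) + (U.1 1 1 : ℤ) * bet t ω T) := by
  obtain ⟨k, hk, hb, hac⟩ := form_k hT
  obtain ⟨k', hk', hb', -⟩ := form_k ((act_disc T U).trans hT)
  have hdet := U.2
  rw [Matrix.det_fin_two] at hdet
  simp only [bet, hk, hk']
  simp only [BQF.act] at hb' ⊢
  generalize U.1 0 0 = p at *
  generalize U.1 0 1 = q at *
  generalize U.1 1 0 = r at *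
  generalize U.1 1 1 = s at *
  have hk2 : k' = T.a * p * q + T.c * r * s + T.b * q * r + k := by
    have : 2 * k' = 2 * (T.a * p * q + T.c * r * s + T.b * q * r + k) := by
      linear_combination -hb' + T.b * hdet + hb
    linarith
  have hac : (T.a : O) * T.c = k ^ 2 + t * k + n := by exact_mod_cast congrArg (Int.cast (R := O)) hac
  have hdet : (p : O) * s - q * r = 1 := by exact_mod_cast congrArg (Int.cast (R := O)) hdet
  have hb : (T.b : O) = t + 2 * k := by exact_mod_cast congrArg (Int.cast (R := O)) hb
  have hsq := h.sq
  subst hk2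
  push_cast
  generalize (T.a : O) = A at *
  generalize (T.b : O) = B at *
  generalize (T.c : O) = C at *
  subst hb
  generalize (p : O) = p at *
  generalize (q : O) = q at *
  generalize (r : O) = r at *
  generalize (s : O) = s at *
  generalize (t : O) = t at *
  generalize (n : O) = n at *
  generalize (k : O) = k at *
  linear_combination r * (hsq + hac) + (A * C * r - (p * A + r * (t + 2 * k)) * (ω + k)) * hdet

theorem span_eq_of_det (e f : O) (p q r s : ℤ) (hdet : p * s - q * r = 1) :
    Ideal.span {(p : O) * e + r * f, (q : O) * e + s * f} = Ideal.span {e, f} := by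
  have hdet : (p : O) * s - q * r = 1 := by exact_mod_cast congrArg (Int.cast (R := O)) hdet
  apply le_antisymm
  · rw [Ideal.span_le]
    rintro z (rfl | rfl)
    · exact Ideal.mem_span_pair.2 ⟨p, r, rfl⟩
    · exact Ideal.mem_span_pair.2 ⟨q, s, rfl⟩
  · rw [Ideal.span_le]
    rintro z (rfl | rfl)
    · exact Ideal.mem_span_pair.2 ⟨s, -r, by linear_combination z * hdet⟩
    · exact Ideal.mem_span_pair.2 ⟨-q, p, by linear_combination z * hdet⟩

theorem act_ideal (h : QBasis O t n ω) {T : BQF} (hT : T.disc = t ^ 2 - 4 * n) (U : SL2Z) :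
    Ideal.span {(U.1 0 0 : ℤ) * (T.a : O) + (U.1 1 0 : ℤ) * bet t ω T} * formIdeal t ω (T.act U) =
    Ideal.span {((T.act U).a : O)} * formIdeal t ω T := by
  have hdet := U.2
  rw [Matrix.det_fin_two] at hdet
  have hb := bet_act h hT U
  rw [formIdeal, formIdeal, ← span_eq_of_det (T.a : O) (bet t ω T) _ _ _ _ hdet, Ideal.span_mul_span',
    Ideal.span_mul_span', Set.singleton_mul, Set.singleton_mul, Set.image_pair, Set.image_pair, hb,
    mul_comm]

theorem inj_ideal [IsDomain O] (h : QBasis O t n ω) {T T' : BQF} (hT : T.disc = t ^ 2 - 4 * n)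
    (hT' : T'.disc = t ^ 2 - 4 * n) (hp : T.PosDef) (hp' : T'.PosDef) (x y : O) (hx : x ≠ 0)
    (hy : y ≠ 0) (hxy : Ideal.span {x} * formIdeal t ω T' = Ideal.span {y} * formIdeal t ω T) :
    ∃ U : SL2Z, T.act U = T' := by
  have hA := posDef_a hp
  have hA' := posDef_a hp'
  have h1 : ∀ z ∈ formIdeal t ω T', ∃ w ∈ formIdeal t ω T, y * w = x * z := by
    intro z hz
    rw [← Ideal.mem_span_singleton_mul, ← hxy]
    exact Ideal.mul_mem_mul (Ideal.mem_span_singleton_self _) hz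
  have h2 : ∀ z ∈ formIdeal t ω T, ∃ w ∈ formIdeal t ω T', x * w = y * z := by
    intro z hz
    rw [← Ideal.mem_span_singleton_mul, hxy]
    exact Ideal.mul_mem_mul (Ideal.mem_span_singleton_self _) hz
  obtain ⟨e1, he1, hxe1⟩ := h1 T'.a (Ideal.subset_span (by simp))
  obtain ⟨e2, he2, hxe2⟩ := h1 (bet t ω T') (Ideal.subset_span (by simp))
  obtain ⟨f1, hf1, hyf1⟩ := h2 T.a (Ideal.subset_span (by simp))
  obtain ⟨f2, hf2, hyf2⟩ := h2 (bet t ω T) (Ideal.subset_span (by simp))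
  obtain ⟨p, r, rfl⟩ := (mem_formIdeal h hT _).1 he1
  obtain ⟨q, s, rfl⟩ := (mem_formIdeal h hT _).1 he2
  obtain ⟨p', r', rfl⟩ := (mem_formIdeal h hT' _).1 hf1
  obtain ⟨q', s', rfl⟩ := (mem_formIdeal h hT' _).1 hf2
  have m1 : ((p' * p + r' * q - 1 : ℤ) : O) * T.a + ((p' * r + r' * s : ℤ) : O) * bet t ω T = 0 := by
    apply mul_left_cancel₀ hy
    push_cast
    linear_combination hyf1 + p' * hxe1 + r' * hxe2
  have m2 : ((q' * p + s' * q : ℤ) : O) * T.a + ((q' * r + s' * s - 1 : ℤ) : O) * bet t ω T = 0 := by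
    apply mul_left_cancel₀ hy
    push_cast
    linear_combination hyf2 + q' * hxe1 + s' * hxe2
  obtain ⟨a1, a2⟩ := uniq_formIdeal h hA.ne' m1
  obtain ⟨a3, a4⟩ := uniq_formIdeal h hA.ne' m2
  have hdd : (p * s - q * r) * (p' * s' - q' * r') = 1 := by
    linear_combination (q' * r + s' * s) * a1 + a4 - (q' * p + s' * q) * a2
  have hK : ((p : O) * T.a + r * bet t ω T) * bet t ω T' = (q * T.a + s * bet t ω T) * T'.a := by
    apply mul_left_cancel₀ hy
    linear_combination bet t ω T' * hxe1 - T'.a * hxe2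
  obtain ⟨k, hk, hb, hac⟩ := form_k hT
  obtain ⟨k', hk', hb', hac'⟩ := form_k hT'
  simp only [bet, hk, hk'] at hK
  obtain ⟨c1, c2⟩ := h.uniq ((p * T.a + r * k) * k' - r * n - (q * T.a + s * k) * T'.a)
    (p * T.a + r * k + r * k' + r * t - s * T'.a) (by
      push_cast
      linear_combination hK - r * h.sq)
  have hTa : T'.a * (p * s - q * r) = T.eval p r := by
    apply mul_left_cancel₀ hA.ne'
    simp only [BQF.eval]
    rw [hb]
    linear_combination r * c1 - (T.a * p + k * r) * c2 - r ^ 2 * hac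
  have hdet : p * s - q * r = 1 := by
    rcases Int.isUnit_iff.1 (IsUnit.of_mul_eq_one _ hdd) with h | h
    · exact h
    · exfalso
      have : 0 < T.eval p r := hp _ _ (by
        rintro ⟨rfl, rfl⟩
        simp at h)
      rw [← hTa, h] at this
      linarith
  rw [hdet, mul_one] at hTa
  have hbb : T'.b = 2 * T.a * p * q + T.b * (p * s + q * r) + 2 * T.c * r * s := by
    have hg : k' = T.a * p * q + T.c * r * s + (t + 2 * k) * q * r + k := by
      simp only [BQF.eval] at hTa
      rw [hb] at hTa
      apply mul_left_cancel₀ (mul_ne_zero hA.ne' hA'.ne')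
      linear_combination (p * T.a + r * (k + t)) * c1 + r * n * c2 + k' * T.a * hTa
        + k' * r ^ 2 * hac - T'.a * s * r * hac + T'.a * T.a * k * hdet
    rw [hb', hg, hb]
    linear_combination -(t + 2 * k) * hdet
  let U : SL2Z := ⟨!![p, q; r, s], by rw [Matrix.det_fin_two_of]; exact hdet⟩
  have hUa : (T.act U).a = T'.a := by rw [hTa]; simp [BQF.act, BQF.eval, U]
  have hUb : (T.act U).b = T'.b := by rw [hbb]; simp [BQF.act, U]
  have hUc : (T.act U).c = T'.c := by
    have hd := (act_disc T U).trans (hT.trans hT'.symm)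
    simp only [BQF.disc, hUa, hUb] at hd
    apply mul_left_cancel₀ hA'.ne'
    linarith
  refine ⟨U, ?_⟩
  cases h1 : T.act U
  cases T'
  simp_all

theorem surj_ideal [IsDomain O] (h : QBasis O t n ω) (hneg : t ^ 2 - 4 * n < 0) (J : Ideal O)
    (m : ℤ) (hm : m ≠ 0) (hmJ : (m : O) ∈ J) :
    ∃ (T : BQF) (g : ℤ), g ≠ 0 ∧ T.disc = t ^ 2 - 4 * n ∧ T.PosDef ∧
      J = Ideal.span {(g : O)} * formIdeal t ω T := by
  let Y : Ideal ℤ :=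
    { carrier := {y | ∃ x : ℤ, (x : O) + y * ω ∈ J}
      zero_mem' := ⟨0, by simp⟩
      add_mem' := by
        rintro a b ⟨x, hx⟩ ⟨x', hx'⟩
        refine ⟨x + x', ?_⟩
        have := J.add_mem hx hx'
        convert this using 1
        push_cast; ring
      smul_mem' := by
        rintro c a ⟨x, hx⟩
        refine ⟨c * x, ?_⟩
        have := J.mul_mem_left (c : O) hx
        convert this using 1
        push_cast [smul_eq_mul]; ring }
  obtain ⟨g, hg⟩ := (IsPrincipalIdealRing.principal Y).principal
  have hgY : ∀ y, y ∈ Y ↔ g ∣ y := by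
    intro y; rw [hg]; exact Ideal.mem_span_singleton
  have hω : ∀ z : ℤ, (z : O) ∈ J → g ∣ z := by
    intro z hz
    rw [← hgY]
    refine ⟨0, ?_⟩
    simpa using J.mul_mem_right ω hz
  have hg0 : g ≠ 0 := by
    rintro rfl
    exact hm (zero_dvd_iff.1 (hω m hmJ))
  have hg0O : (g : O) ≠ 0 := by
    intro h0
    exact hg0 (h.uniq g 0 (by simp [h0])).1
  obtain ⟨n1, hn1⟩ := (IsPrincipalIdealRing.principal (J.comap (Int.castRingHom O))).principal
  have hnJ : ∀ y : ℤ, (y : O) ∈ J ↔ n1 ∣ y := by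
    intro y
    have : (y : O) ∈ J ↔ y ∈ J.comap (Int.castRingHom O) := by simp [Ideal.mem_comap]
    rw [this, hn1]
    exact Ideal.mem_span_singleton
  obtain ⟨A0, hA0⟩ := hω n1 ((hnJ n1).2 dvd_rfl)
  have hn0 : n1 ≠ 0 := by
    rintro rfl
    exact hm (zero_dvd_iff.1 ((hnJ m).1 hmJ))
  -- make the generator positive
  obtain ⟨A, hApos, hAJ⟩ : ∃ A : ℤ, 0 < A ∧ ∀ y : ℤ, (y : O) ∈ J ↔ g * A ∣ y := by
    refine ⟨|A0|, ?_, ?_⟩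
    · apply abs_pos.2
      rintro rfl
      exact hn0 (by simpa using hA0)
    · intro y
      rw [hnJ, hA0]
      rcases abs_choice A0 with h | h <;> rw [h]
      rw [mul_neg, neg_dvd]
  obtain ⟨h0, hh0⟩ := (hgY g).2 dvd_rfl
  have hgh : g ∣ h0 := by
    have : g ∣ h0 + g * t := by
      rw [← hgY]
      refine ⟨-g * n, ?_⟩
      have := J.mul_mem_right ω hh0
      convert this using 1
      push_cast
      linear_combination -(g : O) * h.sq
    have h2 := dvd_sub this (Dvd.intro t rfl)
    simpa using h2
  obtain ⟨k, rfl⟩ := hgh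
  have hβ : (g : O) * (k + ω) ∈ J := by
    convert hh0 using 1
    push_cast; ring
  have hN : A ∣ k ^ 2 + t * k + n := by
    have h1 : ((g * (k ^ 2 + t * k + n) : ℤ) : O) ∈ J := by
      have := J.mul_mem_right ((k : O) + t - ω) hβ
      convert this using 1
      push_cast
      linear_combination (g : O) * h.sq
    have := (hAJ _).1 h1
    exact Int.dvd_of_mul_dvd_mul_left hg0 this
  obtain ⟨c, hc⟩ := hN
  have hbet : bet t ω ⟨A, t + 2 * k, c⟩ = k + ω := by
    simp [bet, add_comm]
  refine ⟨⟨A, t + 2 * k, c⟩, g, hg0, ?_, ?_, ?_⟩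
  · simp only [BQF.disc]; linear_combination 4 * hc
  · refine posDef_of hApos ?_
    have : (BQF.mk A (t + 2 * k) c).disc = t ^ 2 - 4 * n := by
      simp only [BQF.disc]; linear_combination 4 * hc
    rw [this]; exact hneg
  · rw [formIdeal, hbet, Ideal.span_mul_span', Set.singleton_mul, Set.image_pair]
    apply le_antisymm
    · intro z hz
      obtain ⟨x, y, rfl⟩ := h.ex z
      obtain ⟨j, rfl⟩ := (hgY y).1 ⟨x, hz⟩
      have h1 : ((x - g * j * k : ℤ) : O) ∈ J := by
        have := J.sub_mem hz (J.mul_mem_left (j : O) hβ)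
        convert this using 1
        push_cast; ring
      obtain ⟨i, hi⟩ := (hAJ _).1 h1
      have hi : (x : O) - g * j * k = g * A * i := by exact_mod_cast congrArg (Int.cast (R := O)) hi
      rw [Ideal.mem_span_pair]
      refine ⟨i, j, ?_⟩
      push_cast
      linear_combination -hi
    · rw [Ideal.span_le]
      rintro z (rfl | rfl)
      · have := (hAJ _).2 (dvd_refl (g * A))
        simpa using this
      · exact hβ
end

open nonZeroDivisors in
theorem main_aux {O : Type} [CommRing O] [IsDedekindDomain O] {t n : ℤ} {ω : O}
    (hex : ∀ J : Ideal O, J ≠ ⊥ → ∃ m : ℤ, m ≠ 0 ∧ (m : O) ∈ J)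
    (h : QBasis O t n ω) (N : ℕ) (hN : 0 < N) (D : ℤ) (hDneg : D < 0)
    (hD : IsFundamentalDiscriminant D) (hDt : D = t ^ 2 - 4 * n)
    (ρ : ℤ) (hρ : (ρ : ℤ) ^ 2 ≡ D [ZMOD (4 * N)]) :
    Nat.card (Quot (fun T T' : QNDrho N D ρ => ∃ U ∈ Gamma0Set N, T.1.act U = T'.1)) =
      Nat.card (ClassGroup O) := by
  have hne : ∀ T : BQF, T.PosDef → formIdeal t ω T ∈ (Ideal O)⁰ := by
    intro T hT
    rw [mem_nonZeroDivisors_iff_ne_zero]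
    intro h0
    have h1 : (T.a : O) ∈ formIdeal t ω T := Ideal.subset_span (by simp)
    rw [h0] at h1
    have h2 : (T.a : O) = 0 := by simpa using h1
    exact (posDef_a hT).ne' (h.uniq T.a 0 (by simp [h2])).1
  have hcls : ∀ (T : BQF) (hT : T.PosDef) (_ : T.disc = D) (U : SL2Z) (hT' : (T.act U).PosDef),
      ClassGroup.mk0 ⟨_, hne T hT⟩ = ClassGroup.mk0 ⟨_, hne (T.act U) hT'⟩ := by
    intro T hT hd U hT'
    symm
    rw [ClassGroup.mk0_eq_mk0_iff]
    refine ⟨_, _, ?_, ?_, act_ideal h (hd.trans hDt) U⟩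
    · intro h0
      obtain ⟨h1, h2⟩ := uniq_formIdeal h (posDef_a hT).ne' h0
      have hdet := U.2
      rw [Matrix.det_fin_two, h1, h2] at hdet
      simp at hdet
    · intro h0
      exact (posDef_a hT').ne' (h.uniq _ 0 (by simp [h0])).1
  let f : Quot (fun T T' : QNDrho N D ρ => ∃ U ∈ Gamma0Set N, T.1.act U = T'.1) → ClassGroup O :=
    Quot.lift (fun T => ClassGroup.mk0 ⟨formIdeal t ω T.1, hne T.1 T.2.1.1⟩) (by
      rintro ⟨T, hT⟩ ⟨T', hT'⟩ ⟨U, hU, hTU⟩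
      simp only at hTU
      subst hTU
      exact hcls T hT.1.1 hT.1.2.2 U hT'.1.1)
  apply Nat.card_congr
  refine Equiv.ofBijective f ⟨?_, ?_⟩
  · rintro ⟨T⟩ ⟨T'⟩ hTT
    have hTT : ClassGroup.mk0 ⟨formIdeal t ω T.1, hne T.1 T.2.1.1⟩ =
      ClassGroup.mk0 ⟨formIdeal t ω T'.1, hne T'.1 T'.2.1.1⟩ := hTT
    rw [eq_comm, ClassGroup.mk0_eq_mk0_iff] at hTT
    obtain ⟨x, y, hx, hy, hxy⟩ := hTT
    obtain ⟨U, hU⟩ := inj_ideal h (T.2.1.2.2.trans hDt) (T'.2.1.2.2.trans hDt) T.2.1.1 T'.2.1.1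
      x y hx hy hxy
    exact Quot.sound ⟨U, aux_gamma0 N hD T.2 T'.2 U hU, hU⟩
  · intro C
    obtain ⟨⟨J, hJ⟩, rfl⟩ := ClassGroup.mk0_surjective C
    obtain ⟨m, hm, hmJ⟩ := hex J (by rw [mem_nonZeroDivisors_iff_ne_zero] at hJ; exact hJ)
    obtain ⟨T, g, hg, hd, hp, hJT⟩ := surj_ideal h (hDt ▸ hDneg) J m hm hmJ
    obtain ⟨U, hU⟩ := aux_upgrade N hN hDneg hD ρ hρ (hd.trans hDt.symm) hp
    refine ⟨Quot.mk _ ⟨T.act U, hU⟩, ?_⟩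
    show ClassGroup.mk0 ⟨formIdeal t ω (T.act U), hne _ hU.1.1⟩ = _
    rw [← hcls T hp (hd.trans hDt.symm) U hU.1.1, ClassGroup.mk0_eq_mk0_iff]
    refine ⟨(g : O), 1, ?_, one_ne_zero, ?_⟩
    · intro h0
      exact hg (h.uniq g 0 (by simp [h0])).1
    · simp [hJT]

/-- Let `N` be a positive integer, `D < 0` a fundamental discriminant, and `ρ` an integer
with `ρ² ≡ D (mod 4N)`.  Then the number of `Γ₀(N)`-orbits on the set `Q_{N,D,ρ}` of
positive definite forms `[Na, b, c]` of discriminant `D` with `b ≡ ρ (mod 2N)` equals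
`h(D)`, the class number of the imaginary quadratic field `ℚ(√D)` (formalized as any
number field of degree `2` over `ℚ` containing a square root of `D`). -/
theorem stmt3 (N : ℕ) (hN : 0 < N) (D : ℤ) (hDneg : D < 0)
    (hD : IsFundamentalDiscriminant D)
    (ρ : ℤ) (hρ : (ρ : ℤ) ^ 2 ≡ D [ZMOD (4 * N)])
    (K : Type) [Field K] [NumberField K]
    (hdeg : Module.finrank ℚ K = 2) (α : K) (hα : α ^ 2 = (D : K)) :
    Nat.card (Quot (fun T T' : QNDrho N D ρ => ∃ U ∈ Gamma0Set N, T.1.act U = T'.1)) =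
      NumberField.classNumber K := by
  obtain ⟨t, n, ω, hDt, hb⟩ := aux_basis D hDneg hD hdeg α hα
  rw [NumberField.classNumber, ← Nat.card_eq_fintype_card]
  refine main_aux ?_ hb N hN D hDneg hD hDt ρ hρ
  intro J hJ
  refine ⟨(Ideal.absNorm J : ℕ), ?_, ?_⟩
  · have := Ideal.absNorm_ne_zero_iff_mem_nonZeroDivisors.2 (mem_nonZeroDivisors_iff_ne_zero.2 hJ)
    exact_mod_cast this
  · simpa using Ideal.absNorm_mem J
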